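/- Fix an integer p ≥ 1, ε ∈ (0,1/2), r > 0, and α ∈ (0,1/4). Then there exists a constant c > 0 such that for every integer n ≥ 1 and every t ∈ [ε, 1−ε], the probability, under the uniform distribution on (p,2n)-watermelons with wall condition, of the event { W_1(⌊2nt⌋) ≤ n^α and W_p(⌊2nt⌋) ≤ r·√(2n) } is at most c · n^{3(α − 1/2)}. -/

import Mathlib

open MeasureTheory Filter

/-- A star of length `m` with wall condition, with `p` branches, encoded as a
function `Fin p → ℕ → ℤ` (values beyond time `m` are pinned to `0` so that the
collection of stars is a finite set). Branch `i` (0-indexed) starts at `2i`. -/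
def IsStarW (p m : ℕ) (w : Fin p → ℕ → ℤ) : Prop :=
  (∀ i : Fin p, w i 0 = 2 * ((i : ℕ) : ℤ)) ∧
  (∀ i : Fin p, ∀ k, k < m → (w i (k + 1) - w i k = 1 ∨ w i (k + 1) - w i k = -1)) ∧
  (∀ i : Fin p, ∀ k, k ≤ m → 0 ≤ w i k) ∧
  (∀ i j : Fin p, i < j → ∀ k, k ≤ m → w i k < w j k) ∧
  (∀ i : Fin p, ∀ k, m < k → w i k = 0)

/-- A `(p,2n)`-watermelon with wall condition. -/
def IsMelonW (p n : ℕ) (w : Fin p → ℕ → ℤ) : Prop :=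
  IsStarW p (2 * n) w ∧ ∀ i : Fin p, w i (2 * n) = 2 * ((i : ℕ) : ℤ)

/-- Probability of the event `E` under the uniform distribution on
`(p,2n)`-watermelons with wall condition. -/
noncomputable def probW (p n : ℕ) (E : (Fin p → ℕ → ℤ) → Prop) : ℝ :=
  (Nat.card {w : Fin p → ℕ → ℤ // IsMelonW p n w ∧ E w} : ℝ) /
    (Nat.card {w : Fin p → ℕ → ℤ // IsMelonW p n w} : ℝ)

open scoped Nat

/-- The number of nearest-neighbour paths of length `m` from `0` to `e` that stay nonnegative. -/
def ballotCount : ℕ → ℤ → ℤ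
  | 0, e => if e = 0 then 1 else 0
  | m + 1, e => if e < 0 then 0 else ballotCount m (e - 1) + ballotCount m (e + 1)

theorem ballotCount_zero (e : ℤ) : ballotCount 0 e = if e = 0 then 1 else 0 := rfl

theorem ballotCount_succ {m : ℕ} {e : ℤ} (he : 0 ≤ e) :
    ballotCount (m + 1) e = ballotCount m (e - 1) + ballotCount m (e + 1) := by
  rw [ballotCount, if_neg (not_lt.2 he)]

theorem ballotCount_of_neg {m : ℕ} {e : ℤ} (he : e < 0) : ballotCount m e = 0 := by
  cases m with
  | zero => rw [ballotCount, if_neg he.ne]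
  | succ m => rw [ballotCount, if_pos he]

theorem ballotCount_of_lt {m : ℕ} {e : ℤ} (he : (m : ℤ) < e) : ballotCount m e = 0 := by
  induction m generalizing e with
  | zero => rw [ballotCount, if_neg (by push_cast at he; omega)]
  | succ m ih =>
    push_cast at he
    rw [ballotCount_succ (by omega), ih (by omega), ih (by omega), add_zero]

theorem ballotCount_of_parity {m : ℕ} {e : ℤ} (h : (m - e) % 2 ≠ 0) : ballotCount m e = 0 := by
  induction m generalizing e with
  | zero => rw [ballotCount, if_neg (by rintro rfl; simp at h)]
  | succ m ih =>
    rcases lt_or_ge e 0 with he | he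
    · exact ballotCount_of_neg he
    · push_cast at h
      rw [ballotCount_succ he, ih (by omega), ih (by omega), add_zero]

theorem ballotCount_mul_factorial (m : ℕ) : ∀ b e : ℕ, 2 * b + e = m →
    ballotCount m e * ((b + e + 1)! * b !) = (e + 1) * m ! := by
  induction m with
  | zero =>
    intro b e h
    obtain rfl : b = 0 := by omega
    obtain rfl : e = 0 := by omega
    simp [ballotCount_zero]
  | succ m ih =>
    intro b e h
    rw [ballotCount_succ (by positivity)]
    have hm : (m : ℤ) = 2 * b + e - 1 := by omega
    rcases e with _ | e <;> rcases b with _ | b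
    · omega
    · have h1 := ih b 1 (by omega)
      rw [ballotCount_of_neg (by simp)]
      simp only [Nat.factorial_succ, add_zero] at h1 ⊢
      push_cast at h1 hm ⊢
      rw [hm]
      linear_combination ((b : ℤ) + 1) * h1
    · have h1 := ih 0 e (by omega)
      rw [ballotCount_of_lt (e := ((e + 1 : ℕ) : ℤ) + 1) (by push_cast; omega)]
      simp only [Nat.factorial_succ] at h1 ⊢
      push_cast at h1 hm ⊢
      simp only [add_sub_cancel_right, zero_add, Nat.factorial_succ] at h1 ⊢
      push_cast at h1 hm ⊢
      rw [hm]
      linear_combination ((e : ℤ) + 2) * h1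
    · have h1 := ih (b + 1) e (by omega)
      have h2 := ih b (e + 2) (by omega)
      rw [show b + (e + 2) + 1 = b + e + 3 by ring] at h2
      rw [show b + 1 + e + 1 = b + e + 2 by ring] at h1
      rw [show b + 1 + (e + 1) + 1 = b + e + 3 by ring]
      simp only [Nat.factorial_succ] at h1 h2 ⊢
      push_cast at h1 h2 hm ⊢
      rw [show (e : ℤ) + 1 - 1 = e by ring, show (e : ℤ) + 1 + 1 = e + 2 by ring]
      rw [hm]
      linear_combination ((b : ℤ) + e + 3) * h1 + ((b : ℤ) + 1) * h2

theorem ballotCount_self (m : ℕ) : ballotCount m m = 1 := by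
  induction m with
  | zero => simp [ballotCount_zero]
  | succ m ih =>
    rw [ballotCount_succ (by positivity), ballotCount_of_lt (e := ((m + 1 : ℕ) : ℤ) + 1)
      (by push_cast; omega)]
    simpa using ih

/-- The determinant that counts stars of length `m` with end points `e`. -/
def starDet {p : ℕ} (m : ℕ) (e : Fin p → ℤ) : ℤ :=
  (Matrix.of fun i j : Fin p => ballotCount (m + 2 * j) (e i)).det

/-- The step `+1` or `-1` encoded by a Boolean. -/
def signStep (b : Bool) : ℤ := if b then 1 else -1

theorem starDet_of_neg {p m : ℕ} {e : Fin p → ℤ} {i : Fin p} (h : e i < 0) :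
    starDet m e = 0 :=
  Matrix.det_eq_zero_of_row_eq_zero i fun _ => ballotCount_of_neg h

theorem starDet_of_parity {p m : ℕ} {e : Fin p → ℤ} {i : Fin p} (h : (m - e i) % 2 ≠ 0) :
    starDet m e = 0 :=
  Matrix.det_eq_zero_of_row_eq_zero i fun j => ballotCount_of_parity (by push_cast; omega)

theorem starDet_of_eq {p m : ℕ} {e : Fin p → ℤ} {i j : Fin p} (hij : i ≠ j) (h : e i = e j) :
    starDet m e = 0 :=
  Matrix.det_zero_of_row_eq hij (by ext k; simp [h])

theorem starDet_zero {p : ℕ} {e : Fin p → ℤ} (h0 : ∀ i, 0 ≤ e i) (he : StrictMono e) :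
    starDet 0 e = if ∀ i, e i = 2 * ((i : ℕ) : ℤ) then 1 else 0 := by
  by_cases hpar : ∃ i, e i % 2 ≠ 0
  · obtain ⟨i, hi⟩ := hpar
    rw [starDet_of_parity (i := i) (by push_cast; omega), if_neg]
    intro h
    exact hi (by rw [h i]; omega)
  push Not at hpar
  have hge : ∀ k : ℕ, ∀ hk : k < p, 2 * (k : ℤ) ≤ e ⟨k, hk⟩ := by
    intro k
    induction k with
    | zero => intro hk; simpa using h0 _
    | succ k ih =>
      intro hk
      have h1 := ih (by omega)
      have h2 : e ⟨k, by omega⟩ < e ⟨k + 1, hk⟩ := he (by simp [Fin.lt_def])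
      have h3 := hpar ⟨k, by omega⟩
      have h4 := hpar ⟨k + 1, hk⟩
      push_cast
      omega
  have htri : starDet 0 e = ∏ i : Fin p, ballotCount (0 + 2 * i) (e i) := by
    rw [starDet, Matrix.det_of_isUpperTriangular]
    · rfl
    · intro i j hij
      have hij' : j < i := by simpa using hij
      have h1 := hge i i.2
      exact ballotCount_of_lt (by push_cast; simp only [Fin.eta] at h1; omega)
  rw [htri]
  split_ifs with h
  · refine Finset.prod_eq_one fun i _ => ?_
    rw [h i]
    have := ballotCount_self (0 + 2 * i)
    push_cast at this
    simpa using this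
  · push Not at h
    obtain ⟨i, hi⟩ := h
    refine Finset.prod_eq_zero (Finset.mem_univ i) (ballotCount_of_lt ?_)
    have := hge i i.2
    push_cast
    simp only [Fin.eta] at this
    omega

theorem starDet_succ {p m : ℕ} {e : Fin p → ℤ} (h0 : ∀ i, 0 ≤ e i) :
    starDet (m + 1) e = ∑ δ : Fin p → Bool, starDet m fun i => e i - signStep (δ i) := by
  have key := (Matrix.detRowAlternating (n := Fin p) (R := ℤ)).toMultilinearMap.map_sum
    (fun (i : Fin p) (b : Bool) (j : Fin p) => ballotCount (m + 2 * j) (e i - signStep b))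
  have hrow : (Matrix.of fun i j : Fin p => ballotCount (m + 1 + 2 * j) (e i)) =
      fun i => ∑ b : Bool, fun j : Fin p => ballotCount (m + 2 * j) (e i - signStep b) := by
    ext i j
    simp only [Matrix.of_apply, Fintype.sum_bool, Pi.add_apply, signStep, if_true,
      Bool.false_eq_true, if_false, sub_neg_eq_add]
    rw [show m + 1 + 2 * (j : ℕ) = m + 2 * j + 1 by ring, ballotCount_succ (h0 i)]
  rw [starDet, hrow]
  exact key

instance finite_starW (p m : ℕ) : Finite {w : Fin p → ℕ → ℤ // IsStarW p m w} := by
  refine Finite.of_injective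
    (fun w (i : Fin p) (k : Fin m) => decide (w.1 i (k + 1) - w.1 i k = 1)) ?_
  rintro ⟨v, hv⟩ ⟨w, hw⟩ h
  have hstep : ∀ i : Fin p, ∀ k, k < m → v i (k + 1) - v i k = w i (k + 1) - w i k := by
    intro i k hk
    have h1 := congrFun (congrFun h i) ⟨k, hk⟩
    simp only [decide_eq_decide] at h1
    rcases hv.2.1 i k hk with h2 | h2 <;> rcases hw.2.1 i k hk with h3 | h3 <;> omega
  have heq : ∀ i : Fin p, ∀ k, k ≤ m → v i k = w i k := by
    intro i k
    induction k with
    | zero => intro _; rw [hv.1, hw.1]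
    | succ k ih =>
      intro hk
      have := hstep i k (by omega)
      have := ih (by omega)
      omega
  apply Subtype.ext
  funext i k
  rcases le_or_gt k m with hk | hk
  · exact heq i k hk
  · exact (hv.2.2.2.2 i k hk).trans (hw.2.2.2.2 i k hk).symm

instance finite_starW_and (p m : ℕ) (E : (Fin p → ℕ → ℤ) → Prop) :
    Finite {w : Fin p → ℕ → ℤ // IsStarW p m w ∧ E w} :=
  Finite.of_injective
    (fun w => (⟨w.1, w.2.1⟩ : {w : Fin p → ℕ → ℤ // IsStarW p m w}))
    fun _ _ h => Subtype.ext (congrArg (fun x => x.1) h)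

/-- The number of stars of length `m` whose branches end at `e`. -/
noncomputable def starCount {p : ℕ} (m : ℕ) (e : Fin p → ℤ) : ℕ :=
  Nat.card {w : Fin p → ℕ → ℤ // IsStarW p m w ∧ ∀ i, w i m = e i}

theorem starCount_eq_zero {p m : ℕ} {e : Fin p → ℤ} (h : ¬((∀ i, 0 ≤ e i) ∧ StrictMono e)) :
    starCount m e = 0 := by
  rw [starCount, Nat.card_eq_zero]
  left
  constructor
  rintro ⟨w, hw, hwe⟩
  refine h ⟨fun i => ?_, fun i j hij => ?_⟩
  · rw [← hwe]; exact hw.2.2.1 i m le_rfl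
  · rw [← hwe, ← hwe]; exact hw.2.2.2.1 i j hij m le_rfl

theorem starCount_zero {p : ℕ} {e : Fin p → ℤ} (h0 : ∀ i, 0 ≤ e i) (he : StrictMono e) :
    starCount 0 e = if ∀ i, e i = 2 * ((i : ℕ) : ℤ) then 1 else 0 := by
  split_ifs with h
  · rw [starCount, Nat.card_eq_one_iff_unique]
    refine ⟨⟨?_⟩, ⟨⟨fun i k => if k = 0 then e i else 0, ?_, by simp⟩⟩⟩
    · rintro ⟨v, hv, -⟩ ⟨w, hw, -⟩
      apply Subtype.ext
      funext i k
      rcases Nat.eq_zero_or_pos k with rfl | hk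
      · exact (hv.1 i).trans (hw.1 i).symm
      · exact (hv.2.2.2.2 i k hk).trans (hw.2.2.2.2 i k hk).symm
    · refine ⟨by simpa using h, by simp, ?_, ?_, ?_⟩
      · intro i k hk
        obtain rfl : k = 0 := by omega
        simpa using h0 i
      · intro i j hij k hk
        obtain rfl : k = 0 := by omega
        simpa using he hij
      · intro i k hk
        simp [hk.ne']
  · rw [starCount, Nat.card_eq_zero]
    left
    constructor
    rintro ⟨w, hw, hwe⟩
    exact h fun i => (hwe i).symm.trans (hw.1 i)

theorem starCount_succ {p m : ℕ} {e : Fin p → ℤ} (h0 : ∀ i, 0 ≤ e i) (he : StrictMono e) :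
    starCount (m + 1) e = ∑ δ : Fin p → Bool, starCount m fun i => e i - signStep (δ i) := by
  simp only [starCount]
  rw [← Nat.card_sigma]
  symm
  have hs : ∀ b, signStep b = 1 ∨ signStep b = -1 := by decide
  refine Nat.card_eq_of_bijective
    (fun x => ⟨fun i k => if k = m + 1 then e i else x.2.1 i k, ⟨?_, ?_, ?_, ?_, ?_⟩, ?_⟩) ⟨?_, ?_⟩
  · intro i; simpa using x.2.2.1.1 i
  · intro i k hk
    rcases Nat.lt_succ_iff_lt_or_eq.1 hk with h | rfl
    · simpa [h.ne, (h.trans (Nat.lt_succ_self m)).ne] using x.2.2.1.2.1 i k h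
    · have := x.2.2.2 i
      have := hs (x.1 i)
      simp
      omega
  · intro i k hk
    rcases Nat.le_succ_iff.1 hk with h | rfl
    · simpa [(Nat.lt_succ_of_le h).ne] using x.2.2.1.2.2.1 i k h
    · simpa using h0 i
  · intro i j hij k hk
    rcases Nat.le_succ_iff.1 hk with h | rfl
    · simpa [(Nat.lt_succ_of_le h).ne] using x.2.2.1.2.2.2.1 i j hij k h
    · simpa using he hij
  · intro i k hk
    simpa [hk.ne'] using x.2.2.1.2.2.2.2 i k (by omega)
  · simp
  · rintro ⟨δ, v, hv, hve⟩ ⟨η, w, hw, hwe⟩ h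
    have hvw : v = w := by
      funext i k
      by_cases hk : k = m + 1
      · rw [hv.2.2.2.2 i k (by omega), hw.2.2.2.2 i k (by omega)]
      · have := congrFun (congrFun (congrArg Subtype.val h) i) k
        simpa [hk] using this
    subst hvw
    have hδ : δ = η := by
      funext i
      have h1 := hve i
      have h2 := hwe i
      have h3 : signStep (δ i) = signStep (η i) := by omega
      revert h3
      cases δ i <;> cases η i <;> simp [signStep]
    subst hδ
    rfl
  · rintro ⟨w, hw, hwe⟩
    refine ⟨⟨fun i => decide (w i (m + 1) - w i m = 1),
      fun i k => if k = m + 1 then 0 else w i k, ⟨?_, ?_, ?_, ?_, ?_⟩, ?_⟩, ?_⟩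
    · intro i; simpa using hw.1 i
    · intro i k hk
      simpa [show k ≠ m + 1 by omega, hk.ne] using hw.2.1 i k (by omega)
    · intro i k hk
      simpa [show k ≠ m + 1 by omega] using hw.2.2.1 i k (by omega)
    · intro i j hij k hk
      simpa [show k ≠ m + 1 by omega] using hw.2.2.2.1 i j hij k (by omega)
    · intro i k hk
      by_cases h : k = m + 1
      · simp [h]
      · simpa [h] using hw.2.2.2.2 i k (by omega)
    · intro i
      have := hwe i
      rcases hw.2.1 i m (by omega) with h | h
      · simp [signStep, h]; omega
      · simp [signStep, h]; omega
    · apply Subtype.ext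
      funext i k
      by_cases h : k = m + 1
      · simp [h, hwe]
      · simp [h]

theorem starCount_eq_starDet {p : ℕ} (m : ℕ) {e : Fin p → ℤ} (h0 : ∀ i, 0 ≤ e i)
    (he : StrictMono e) : (starCount m e : ℤ) = starDet m e := by
  induction m generalizing e with
  | zero => rw [starCount_zero h0 he, starDet_zero h0 he]; split_ifs <;> rfl
  | succ m ih =>
    rw [starCount_succ h0 he, starDet_succ h0, Nat.cast_sum]
    refine Finset.sum_congr rfl fun δ _ => ?_
    have hs : ∀ b, signStep b = 1 ∨ signStep b = -1 := by decide
    by_cases h : (∀ i, 0 ≤ e i - signStep (δ i)) ∧ StrictMono fun i => e i - signStep (δ i)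
    · exact ih h.1 h.2
    rw [starCount_eq_zero h, Nat.cast_zero]
    symm
    by_cases hpar : ∃ i, ((m : ℤ) - (e i - signStep (δ i))) % 2 ≠ 0
    · obtain ⟨i, hi⟩ := hpar
      exact starDet_of_parity hi
    by_cases hneg : ∃ i, e i - signStep (δ i) < 0
    · obtain ⟨i, hi⟩ := hneg
      exact starDet_of_neg hi
    push Not at hpar hneg
    have hmono : ¬StrictMono fun i => e i - signStep (δ i) := fun hm => h ⟨hneg, hm⟩
    simp only [StrictMono, not_forall] at hmono
    obtain ⟨i, j, hij, hle⟩ := hmono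
    refine starDet_of_eq hij.ne ?_
    have h1 := hpar i
    have h2 := hpar j
    have h3 := hs (δ i)
    have h4 := hs (δ j)
    have h5 := he hij
    omega

theorem factorial_mul_factorial_eq_prod (b e j q : ℕ) :
    (b + j + q + e + 1)! * (b + j + q)! = (b + j + e + 1)! * (b + j)! *
      ∏ t ∈ Finset.Ico (j + 1) (j + 1 + q), (b * (b + e + 1) + (t * (2 * b + e + 1) + t ^ 2)) := by
  induction q with
  | zero => simp
  | succ q ih =>
    rw [← add_assoc (j + 1), Finset.prod_Ico_succ_top (by omega), ← mul_assoc, ← ih,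
      show b + j + (q + 1) + e + 1 = b + j + q + e + 1 + 1 by ring,
      show b + j + (q + 1) = b + j + q + 1 by ring, Nat.factorial_succ, Nat.factorial_succ (b + j + q)]
    ring

theorem ballotCount_eq_mul_prod {p m b e j : ℕ} (h : 2 * b + e = m) (hj : j < p) :
    (ballotCount (m + 2 * j) e : ℝ) = (e + 1) / ((b + e + p)! * (b + p - 1)!) * ((m + 2 * j)! *
      ∏ t ∈ Finset.Ico (j + 1) p, ((b : ℝ) * (b + e + 1) + (t * (m + 1) + t ^ 2))) := by
  obtain ⟨q, rfl⟩ := Nat.exists_eq_add_of_lt hj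
  have h1 := factorial_mul_factorial_eq_prod b e j q
  have h2 := ballotCount_mul_factorial (m + 2 * j) (b + j) e (by omega)
  rw [show j + 1 + q = j + q + 1 by ring] at h1
  rw [show b + e + (j + q + 1) = b + j + q + e + 1 by ring,
    show b + (j + q + 1) - 1 = b + j + q by omega]
  have h1' : (((b + j + q + e + 1)! : ℕ) : ℝ) * (b + j + q)! = (b + j + e + 1)! * (b + j)! *
      ∏ t ∈ Finset.Ico (j + 1) (j + q + 1),
        ((b : ℝ) * (b + e + 1) + (t * (m + 1) + t ^ 2)) := by
    subst h
    exact_mod_cast h1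
  have h2' : (ballotCount (m + 2 * j) e : ℝ) * ((b + j + e + 1)! * (b + j)!) =
      (e + 1) * (m + 2 * j)! := by exact_mod_cast h2
  have h3 : (((b + j + q + e + 1)! : ℕ) : ℝ) * (b + j + q)! ≠ 0 := by positivity
  rw [div_mul_eq_mul_div, eq_div_iff h3, h1']
  linear_combination (∏ t ∈ Finset.Ico (j + 1) (j + q + 1),
    ((b : ℝ) * (b + e + 1) + (t * (m + 1) + t ^ 2))) * h2'

theorem abs_det_eval_prod {p : ℕ} (u : Fin p → ℝ) (a : ℕ → ℝ) :
    |(Matrix.of fun i j : Fin p => ∏ t ∈ Finset.Ico ((j : ℕ) + 1) p, (u i + a t)).det| =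
      ∏ i, ∏ j ∈ Finset.Ioi i, |u j - u i| := by
  let P : Fin p → Polynomial ℝ := fun k =>
    ∏ t ∈ Finset.Ico ((k.rev : ℕ) + 1) p, (Polynomial.X + Polynomial.C (a t))
  have hP : ∀ k, (P k).Monic := fun k =>
    Polynomial.monic_prod_of_monic _ _ fun t _ => Polynomial.monic_X_add_C _
  have hdeg : ∀ k, (P k).natDegree = k := fun k => by
    rw [Polynomial.natDegree_prod_of_monic _ _ fun t _ => Polynomial.monic_X_add_C _]
    simp [Fin.val_rev]
    omega
  have h := Matrix.det_eval_matrixOfPolynomials_eq_det_vandermonde u P hdeg hP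
  rw [Matrix.det_vandermonde] at h
  have h' := congrArg abs h
  simp only [Finset.abs_prod] at h'
  rw [h', ← Matrix.abs_det_submatrix_equiv_equiv (Equiv.refl _) Fin.revPerm]
  congr 2
  ext i j
  simp [P, Polynomial.eval_prod]

theorem starCount_eq_prod {p m : ℕ} {e b : Fin p → ℕ} (he : StrictMono e)
    (hb : ∀ i, 2 * b i + e i = m) :
    (starCount m (fun i => (e i : ℤ)) : ℝ) =
      ∏ i : Fin p, (((e i : ℝ) + 1) *
        ((m + 2 * i)! / ((b i + e i + p)! * (b i + p - 1)!)) *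
        ∏ j ∈ Finset.Ioi i, |(b j : ℝ) * (b j + e j + 1) - b i * (b i + e i + 1)|) := by
  have h1 := starCount_eq_starDet m (e := fun i => (e i : ℤ)) (fun i => by positivity)
    fun i j hij => Int.ofNat_lt.2 (he hij)
  have h2 : (starCount m (fun i => (e i : ℤ)) : ℝ) =
      |(Matrix.of fun i j : Fin p => (ballotCount (m + 2 * j) (e i) : ℝ)).det| := by
    rw [← abs_of_nonneg (Nat.cast_nonneg (α := ℝ) (starCount m fun i => (e i : ℤ))),
      ← Int.cast_natCast, h1, starDet, Int.cast_det]
    rfl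
  rw [h2]
  simp_rw [ballotCount_eq_mul_prod (hb _) (Fin.is_lt _)]
  rw [Matrix.det_mul_column (fun i => ((e i : ℝ) + 1) / ((b i + e i + p)! * (b i + p - 1)!))
      (fun i j : Fin p => ((m + 2 * j)! : ℝ) *
        ∏ t ∈ Finset.Ico ((j : ℕ) + 1) p, ((b i : ℝ) * (b i + e i + 1) + (t * (m + 1) + t ^ 2)))]
  have h3 := Matrix.det_mul_row (fun j : Fin p => ((m + 2 * j)! : ℝ)) (Matrix.of fun i j : Fin p =>
        ∏ t ∈ Finset.Ico ((j : ℕ) + 1) p,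
          ((b i : ℝ) * (b i + e i + 1) + ((t : ℝ) * (m + 1) + (t : ℝ) ^ 2)))
  have h4 := abs_det_eval_prod (fun i => (b i : ℝ) * (b i + e i + 1))
    (fun t => (t : ℝ) * (m + 1) + (t : ℝ) ^ 2)
  simp only [Matrix.of_apply] at h3
  change |_ * Matrix.det (Matrix.of fun i j : Fin p => ((m + 2 * j)! : ℝ) * _)| = _
  rw [h3, abs_mul, abs_mul, h4, abs_of_nonneg (by positivity), abs_of_nonneg (by positivity),
    ← mul_assoc, ← Finset.prod_mul_distrib, ← Finset.prod_mul_distrib]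
  refine Finset.prod_congr rfl fun i _ => ?_
  ring

theorem centralBinom_sq_mul_le (h : ℕ) : (h.centralBinom : ℝ) ^ 2 * (2 * h + 1) ≤ 16 ^ h := by
  induction h with
  | zero => simp
  | succ h ih =>
    have hrec : ((h : ℝ) + 1) * (h + 1).centralBinom = 2 * (2 * h + 1) * h.centralBinom := by
      exact_mod_cast Nat.succ_mul_centralBinom_succ h
    have hpos : (0 : ℝ) < ((h : ℝ) + 1) ^ 2 := by positivity
    refine le_of_mul_le_mul_left ?_ hpos
    calc ((h : ℝ) + 1) ^ 2 * (((h + 1).centralBinom : ℝ) ^ 2 * (2 * ((h + 1 : ℕ) : ℝ) + 1))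
        = (((h : ℝ) + 1) * (h + 1).centralBinom) ^ 2 * (2 * h + 3) := by push_cast; ring
      _ = ((h.centralBinom : ℝ) ^ 2 * (2 * h + 1)) * (4 * (2 * h + 1) * (2 * h + 3)) := by
        rw [hrec]; ring
      _ ≤ 16 ^ h * (16 * ((h : ℝ) + 1) ^ 2) :=
        mul_le_mul ih (by nlinarith) (by positivity) (by positivity)
      _ = _ := by ring

theorem le_centralBinom_sq_mul {h : ℕ} (hh : 1 ≤ h) :
    (16 : ℝ) ^ h ≤ (h.centralBinom : ℝ) ^ 2 * (4 * h) := by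
  induction h, hh using Nat.le_induction with
  | base => norm_num [Nat.centralBinom, Nat.choose]
  | succ h hh ih =>
    have hrec : ((h : ℝ) + 1) * (h + 1).centralBinom = 2 * (2 * h + 1) * h.centralBinom := by
      exact_mod_cast Nat.succ_mul_centralBinom_succ h
    have hpos : (0 : ℝ) < (h : ℝ) + 1 := by positivity
    refine le_of_mul_le_mul_left ?_ hpos
    calc ((h : ℝ) + 1) * 16 ^ (h + 1) = 16 * (h + 1) * 16 ^ h := by ring
      _ ≤ 16 * (h + 1) * ((h.centralBinom : ℝ) ^ 2 * (4 * h)) := by gcongr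
      _ = (h.centralBinom : ℝ) ^ 2 * 4 * (16 * (h * (h + 1))) := by ring
      _ ≤ (h.centralBinom : ℝ) ^ 2 * 4 * (2 * (2 * h + 1)) ^ 2 := by
        gcongr
        nlinarith
      _ = (((h : ℝ) + 1) * (h + 1).centralBinom) ^ 2 * 4 := by rw [hrec]; ring
      _ = _ := by push_cast; ring

theorem choose_mul_sqrt_le (M k : ℕ) : (M.choose k : ℝ) * √M ≤ 3 * 2 ^ M := by
  set h := (M + 1) / 2 with hdef
  have h1 : M.choose k ≤ h.centralBinom :=
    (Nat.choose_le_choose k (by omega : M ≤ 2 * h)).trans (Nat.choose_le_centralBinom k h)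
  have h1' : (M.choose k : ℝ) ≤ h.centralBinom := by exact_mod_cast h1
  have h2 : (M : ℝ) ≤ 2 * h + 1 := by exact_mod_cast (by omega : M ≤ 2 * h + 1)
  have h3 : (16 : ℝ) ^ h ≤ 4 ^ (M + 1) := by
    rw [show (16 : ℝ) = 4 ^ 2 by norm_num, ← pow_mul]
    exact pow_le_pow_right₀ (by norm_num) (by omega)
  refine le_of_sq_le_sq ?_ (by positivity)
  calc ((M.choose k : ℝ) * √M) ^ 2 = (M.choose k : ℝ) ^ 2 * M := by
        rw [mul_pow, Real.sq_sqrt (by positivity)]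
    _ ≤ (h.centralBinom : ℝ) ^ 2 * (2 * h + 1) := by gcongr
    _ ≤ 4 ^ (M + 1) := (centralBinom_sq_mul_le h).trans h3
    _ ≤ 9 * (2 ^ M) ^ 2 := by
      rw [← pow_mul, mul_comm M, pow_mul, pow_succ]
      norm_num
      have : (0 : ℝ) < 4 ^ M := by positivity
      linarith
    _ = (3 * 2 ^ M) ^ 2 := by ring

theorem four_pow_le_centralBinom_mul_sqrt {n : ℕ} (hn : 1 ≤ n) :
    (4 : ℝ) ^ n ≤ n.centralBinom * (2 * √n) := by
  refine le_of_sq_le_sq ?_ (by positivity)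
  calc ((4 : ℝ) ^ n) ^ 2 = 16 ^ n := by rw [← pow_mul, mul_comm, pow_mul]; norm_num
    _ ≤ _ := le_centralBinom_sq_mul hn
    _ = (n.centralBinom * (2 * √n)) ^ 2 := by
      rw [mul_pow, mul_pow, Real.sq_sqrt (by positivity)]; ring

theorem factorial_div_mul_le {p m b e i : ℕ} (h : 2 * b + e = m) (hi : i < p) :
    ((m + 2 * i)! / ((b + e + p)! * (b + p - 1)!) : ℝ) * ((m : ℝ) ^ (2 * (p - 1 - i) + 1) * √m) ≤
      3 * 4 ^ p * 2 ^ m := by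
  have hM : b + e + p + (b + p - 1) = m + 2 * p - 1 := by omega
  have h1 := Nat.add_choose_mul_factorial_mul_factorial (b + e + p) (b + p - 1)
  rw [hM] at h1
  have h1' : ((m + 2 * p - 1).choose (b + p - 1) : ℝ) * ((b + e + p)! * (b + p - 1)!) =
      (m + 2 * p - 1)! := by rw [← mul_assoc]; exact_mod_cast h1
  have h2 : (m + 2 * i)! * m ^ (2 * (p - 1 - i) + 1) ≤ (m + 2 * p - 1)! := by
    refine le_trans ?_ ((Nat.factorial_mul_pow_le_factorial (m := m + 2 * i)
      (n := 2 * (p - 1 - i) + 1)).trans (Nat.factorial_le (by omega)))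
    exact Nat.mul_le_mul_left _ (Nat.pow_le_pow_left (by omega) _)
  have h2' : ((m + 2 * i)! : ℝ) * (m : ℝ) ^ (2 * (p - 1 - i) + 1) ≤ (m + 2 * p - 1)! := by
    exact_mod_cast h2
  have h3 := choose_mul_sqrt_le (m + 2 * p - 1) (b + p - 1)
  have hs : √(m : ℝ) ≤ √((m + 2 * p - 1 : ℕ) : ℝ) :=
    Real.sqrt_le_sqrt (by exact_mod_cast (by omega : m ≤ m + 2 * p - 1))
  have hF : (0 : ℝ) < (b + e + p)! * (b + p - 1)! := by positivity
  calc ((m + 2 * i)! / ((b + e + p)! * (b + p - 1)!) : ℝ) *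
        ((m : ℝ) ^ (2 * (p - 1 - i) + 1) * √m)
      = ((m + 2 * i)! : ℝ) * (m : ℝ) ^ (2 * (p - 1 - i) + 1) /
        ((b + e + p)! * (b + p - 1)!) * √m := by ring
    _ ≤ (m + 2 * p - 1)! / ((b + e + p)! * (b + p - 1)!) * √((m + 2 * p - 1 : ℕ) : ℝ) := by
      gcongr
    _ = (m + 2 * p - 1).choose (b + p - 1) * √((m + 2 * p - 1 : ℕ) : ℝ) := by
      rw [← h1', mul_div_cancel_right₀ _ hF.ne']
    _ ≤ 3 * 2 ^ (m + 2 * p - 1) := h3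
    _ ≤ 3 * 2 ^ (m + 2 * p) := by gcongr <;> norm_num
    _ = 3 * 4 ^ p * 2 ^ m := by
      rw [pow_add, pow_mul 2 2 p]
      norm_num
      ring

theorem le_factorial_div {p n i : ℕ} (hn : 1 ≤ n) (hpn : p ≤ n) (hi : i < p) :
    (4 : ℝ) ^ n * n ^ (2 * i) / (2 * √n * ((1 + 2 * p) * n) ^ (2 * p - 1)) ≤
      (2 * n + 2 * i)! / ((n - i + 2 * i + p)! * (n - i + p - 1)!) := by
  have hup : ∀ k, k ≤ 2 * p → ((n + k)! : ℝ) ≤ n ! * ((1 + 2 * p) * n) ^ k := by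
    intro k hk
    have h1 : (n + k)! ≤ n ! * ((1 + 2 * p) * n) ^ k := by
      rw [← Nat.factorial_mul_ascFactorial]
      refine Nat.mul_le_mul_left _ ((Nat.ascFactorial_le_pow_add n k).trans
        (Nat.pow_le_pow_left ?_ k))
      nlinarith
    exact_mod_cast h1
  have hlow : ((2 * n)! : ℝ) * (n : ℝ) ^ (2 * i) ≤ (2 * n + 2 * i)! := by
    have h1 : (2 * n)! * n ^ (2 * i) ≤ (2 * n + 2 * i)! :=
      le_trans (Nat.mul_le_mul_left _ (Nat.pow_le_pow_left (by omega) _))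
        Nat.factorial_mul_pow_le_factorial
    exact_mod_cast h1
  have hcb : ((2 * n)! : ℝ) = n.centralBinom * (n ! * n !) := by
    have := Nat.add_choose_mul_factorial_mul_factorial n n
    rw [← two_mul] at this
    rw [← this, Nat.centralBinom]
    push_cast
    ring
  have h4 := four_pow_le_centralBinom_mul_sqrt hn
  have hn0 : (0 : ℝ) < n := by exact_mod_cast hn
  have hsq : 0 < √(n : ℝ) := Real.sqrt_pos.2 hn0
  rw [show n - i + 2 * i + p = n + (i + p) by omega,
    show n - i + p - 1 = n + (p - 1 - i) by omega]
  rw [div_le_div_iff₀ (by positivity) (by positivity)]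
  calc (4 : ℝ) ^ n * n ^ (2 * i) * ((n + (i + p))! * (n + (p - 1 - i))!)
      ≤ (n.centralBinom * (2 * √n)) * n ^ (2 * i) * ((n ! * ((1 + 2 * p) * n) ^ (i + p)) *
          (n ! * ((1 + 2 * p) * n) ^ (p - 1 - i))) := by
        gcongr
        · exact hup _ (by omega)
        · exact hup _ (by omega)
    _ = ((2 * n)! * (n : ℝ) ^ (2 * i)) * (2 * √n * ((1 + 2 * p) * n) ^ (2 * p - 1)) := by
      rw [hcb, show 2 * p - 1 = (i + p) + (p - 1 - i) by omega, pow_add _ (i + p)]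
      ring
    _ ≤ _ := by gcongr

theorem starCount_le {p n m : ℕ} {ε C : ℝ} (hn : 1 ≤ n) (hε : 0 < ε) (hm : ε * n ≤ m)
    {e : Fin p → ℤ} (hem : ∀ i, e i ≤ m) {X : Fin p → ℝ} (hX : ∀ i, (e i : ℝ) + 1 ≤ X i)
    (hX0 : ∀ i, 0 ≤ X i) (hXC : ∀ i, X i ≤ C * √n) :
    (starCount m e : ℝ) ≤ ∏ i : Fin p, (X i * (3 * 4 ^ p * 2 ^ m /
      ((ε * n) ^ (2 * (p - 1 - i : ℕ) + 1) * (√ε * √n))) * (C ^ 2 * n) ^ (p - 1 - i : ℕ)) := by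
  have hn0 : (0 : ℝ) < n := by exact_mod_cast hn
  have hsq : 0 < √(n : ℝ) := Real.sqrt_pos.2 hn0
  have hsε : 0 < √ε := Real.sqrt_pos.2 hε
  have hnonneg : 0 ≤ ∏ i : Fin p, (X i * (3 * 4 ^ p * 2 ^ m /
      ((ε * n) ^ (2 * (p - 1 - i : ℕ) + 1) * (√ε * √n))) * (C ^ 2 * n) ^ (p - 1 - i : ℕ)) :=
    Finset.prod_nonneg fun i _ => by have := hX0 i; positivity
  by_cases h : (∀ i, 0 ≤ e i) ∧ StrictMono e
  swap
  · rw [starCount_eq_zero h, Nat.cast_zero]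
    exact hnonneg
  obtain ⟨h0, he⟩ := h
  by_cases hpar : ∃ i, ((m : ℤ) - e i) % 2 ≠ 0
  · obtain ⟨i, hi⟩ := hpar
    have h1 := starCount_eq_starDet m h0 he
    rw [starDet_of_parity hi] at h1
    rw [show starCount m e = 0 by exact_mod_cast h1, Nat.cast_zero]
    exact hnonneg
  push Not at hpar
  lift e to Fin p → ℕ using h0
  have hb : ∀ i, 2 * ((m - e i) / 2) + e i = m := by
    intro i
    have h1 := hpar i
    have h2 := hem i
    dsimp only at h1 h2
    omega
  rw [starCount_eq_prod (fun i j hij => Int.ofNat_lt.1 (he hij)) hb]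
  refine Finset.prod_le_prod (fun i _ => by positivity) fun i _ => ?_
  set b : Fin p → ℕ := fun i => (m - e i) / 2
  change ∀ i, 2 * b i + e i = m at hb
  have hb' : ∀ i, (b i : ℝ) = (m - e i) / 2 := fun i => by
    have : (2 : ℝ) * b i + e i = m := by exact_mod_cast hb i
    linarith
  have hsqle : ∀ i, ((e i : ℝ) + 1) ^ 2 ≤ C ^ 2 * n := fun i => by
    have h1 : (e i : ℝ) + 1 ≤ C * √n := le_trans (by simpa using hX i) (hXC i)
    calc ((e i : ℝ) + 1) ^ 2 ≤ (C * √n) ^ 2 := by gcongr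
      _ = C ^ 2 * n := by rw [mul_pow, Real.sq_sqrt hn0.le]
  have hfac := factorial_div_mul_le (hb i) i.2
  have hdenom : (ε * n) ^ (2 * (p - 1 - i : ℕ) + 1) * (√ε * √n) ≤
      (m : ℝ) ^ (2 * (p - 1 - i : ℕ) + 1) * √m := by
    rw [← Real.sqrt_mul hε.le]
    gcongr
  refine mul_le_mul (mul_le_mul (by simpa using hX i) ?_ (by positivity) (hX0 i)) ?_
    (by positivity) (mul_nonneg (hX0 i) (by positivity))
  · rw [le_div_iff₀ (by positivity)]
    exact le_trans (mul_le_mul_of_nonneg_left hdenom (by positivity)) hfac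
  · calc ∏ j ∈ Finset.Ioi i, |(b j : ℝ) * (b j + e j + 1) - b i * (b i + e i + 1)|
        ≤ ∏ j ∈ Finset.Ioi i, C ^ 2 * n := by
          refine Finset.prod_le_prod (fun _ _ => abs_nonneg _) fun j _ => ?_
          have h1 := hsqle i
          have h2 := hsqle j
          have h3 : (b j : ℝ) * (b j + e j + 1) - b i * (b i + e i + 1) =
              (((e i : ℝ) + 1) ^ 2 - ((e j : ℝ) + 1) ^ 2) / 4 := by
            rw [hb' i, hb' j]; ring
          rw [h3, abs_le]
          constructor <;> nlinarith [sq_nonneg ((e i : ℝ) + 1), sq_nonneg ((e j : ℝ) + 1)]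
      _ = _ := by rw [Finset.prod_const, Fin.card_Ioi]

theorem le_starCount {p n : ℕ} (hn : 1 ≤ n) (hpn : p ≤ n) :
    ∏ i : Fin p, ((4 : ℝ) ^ n * n ^ (2 * (i : ℕ)) /
      (2 * √n * ((1 + 2 * p) * n) ^ (2 * p - 1))) ≤
      (starCount (p := p) (2 * n) (fun i => 2 * ((i : ℕ) : ℤ)) : ℝ) := by
  have hb : ∀ i : Fin p, 2 * (n - i : ℕ) + 2 * (i : ℕ) = 2 * n := fun i => by omega
  have h := starCount_eq_prod (e := fun i : Fin p => 2 * (i : ℕ))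
    (fun i j hij => by simpa using hij) hb
  push_cast at h
  rw [h]
  refine Finset.prod_le_prod (fun i _ => by positivity) fun i _ => ?_
  have h1 := le_factorial_div hn hpn i.2
  have h2 : 1 ≤ ∏ j ∈ Finset.Ioi i, |((n - j : ℕ) : ℝ) * ((n - j : ℕ) + 2 * (j : ℕ) + 1) -
      (n - i : ℕ) * ((n - i : ℕ) + 2 * (i : ℕ) + 1)| := by
    refine (Finset.prod_const_one (s := Finset.Ioi i)).symm.le.trans
      (Finset.prod_le_prod (fun _ _ => zero_le_one) fun j hj => ?_)
    have hij : (i : ℕ) < j := by simpa using hj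
    have hij' : (i : ℝ) + 1 ≤ j := by exact_mod_cast hij
    have hi0 : (0 : ℝ) ≤ (i : ℕ) := by positivity
    rw [abs_sub_comm, Nat.cast_sub (by omega), Nat.cast_sub (by omega)]
    refine le_trans ?_ (le_abs_self _)
    nlinarith
  calc _ ≤ _ := h1
    _ = 1 * ((2 * n + 2 * (i : ℕ))! / ((n - i + 2 * i + p)! * (n - i + p - 1)!)) * 1 := by ring
    _ ≤ _ := by
      gcongr
      linarith [(by positivity : (0 : ℝ) ≤ 2 * (i : ℕ))]

theorem IsMelonW.truncate {p n m : ℕ} (hm : m ≤ 2 * n) {w : Fin p → ℕ → ℤ} (hw : IsMelonW p n w) :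
    IsStarW p m fun i k => if k ≤ m then w i k else 0 := by
  obtain ⟨⟨h0, hstep, hnonneg, hlt, -⟩, -⟩ := hw
  refine ⟨fun i => by simpa using h0 i, fun i k hk => ?_, fun i k hk => ?_,
    fun i j hij k hk => ?_, fun i k hk => if_neg (by omega)⟩
  · simpa [hk.le, Nat.succ_le_of_lt hk] using hstep i k (by omega)
  · simpa [hk] using hnonneg i k (by omega)
  · simpa [hk] using hlt i j hij k (by omega)

theorem IsMelonW.truncate_reverse {p n m : ℕ} (hm : m ≤ 2 * n) {w : Fin p → ℕ → ℤ}
    (hw : IsMelonW p n w) :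
    IsStarW p (2 * n - m) fun i k => if k ≤ 2 * n - m then w i (2 * n - k) else 0 := by
  obtain ⟨⟨-, hstep, hnonneg, hlt, -⟩, hend⟩ := hw
  refine ⟨fun i => by simpa using hend i, fun i k hk => ?_, fun i k hk => ?_,
    fun i j hij k hk => ?_, fun i k hk => if_neg (by omega)⟩
  · have h := hstep i (2 * n - (k + 1)) (by omega)
    rw [show 2 * n - (k + 1) + 1 = 2 * n - k by omega] at h
    simp only [hk.le, Nat.succ_le_of_lt hk, if_true]
    omega
  · simpa [hk] using hnonneg i (2 * n - k) (by omega)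
  · simpa [hk] using hlt i j hij (2 * n - k) (by omega)

theorem card_isMelonW_and_le_sum {p n m : ℕ} (hm : m ≤ 2 * n) {E : (Fin p → ℕ → ℤ) → Prop}
    {T : Finset (Fin p → ℤ)}
    (hT : ∀ w, IsMelonW p n w → E w → (fun i => w i m) ∈ T) :
    Nat.card {w : Fin p → ℕ → ℤ // IsMelonW p n w ∧ E w} ≤
      ∑ e ∈ T, starCount m e * starCount (2 * n - m) e := by
  simp only [starCount]
  rw [← Finset.sum_coe_sort]
  simp only [← Nat.card_prod]
  rw [← Nat.card_sigma]
  refine Nat.card_le_card_of_injective (fun w => ⟨⟨fun i => w.1 i m, hT w.1 w.2.1 w.2.2⟩,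
    ⟨_, w.2.1.truncate hm, ?_⟩, ⟨_, w.2.1.truncate_reverse hm, ?_⟩⟩) ?_
  · simp
  · intro i
    simp [Nat.sub_sub_self hm]
  · rintro ⟨v, hv, _⟩ ⟨w, hw, _⟩ h
    have h1 := congrArg (fun x : (e : T) ×
      ({w : Fin p → ℕ → ℤ // IsStarW p m w ∧ ∀ i, w i m = e.1 i} ×
      {w : Fin p → ℕ → ℤ // IsStarW p (2 * n - m) w ∧ ∀ i, w i (2 * n - m) = e.1 i}) =>
        x.2.1.1) h
    have h2 := congrArg (fun x : (e : T) ×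
      ({w : Fin p → ℕ → ℤ // IsStarW p m w ∧ ∀ i, w i m = e.1 i} ×
      {w : Fin p → ℕ → ℤ // IsStarW p (2 * n - m) w ∧ ∀ i, w i (2 * n - m) = e.1 i}) =>
        x.2.2.1) h
    apply Subtype.ext
    funext i k
    change v i k = w i k
    rcases le_or_gt k m with hk | hk
    · simpa [hk] using congrFun (congrFun h1 i) k
    rcases le_or_gt k (2 * n) with hk' | hk'
    · have h3 := congrFun (congrFun h2 i) (2 * n - k)
      simpa [show 2 * n - k ≤ 2 * n - m by omega, Nat.sub_sub_self hk'] using h3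
    · exact (hv.1.2.2.2.2 i k hk').trans (hw.1.2.2.2.2 i k hk').symm

instance finite_melonW (p n : ℕ) : Finite {w : Fin p → ℕ → ℤ // IsMelonW p n w} :=
  finite_starW_and p (2 * n) _

theorem probW_le_one (p n : ℕ) (E : (Fin p → ℕ → ℤ) → Prop) : probW p n E ≤ 1 := by
  refine div_le_one_of_le₀ ?_ (by positivity)
  exact_mod_cast Nat.card_le_card_of_injective
    (fun w : {w : Fin p → ℕ → ℤ // IsMelonW p n w ∧ E w} =>
      (⟨w.1, w.2.1⟩ : {w : Fin p → ℕ → ℤ // IsMelonW p n w}))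
    fun _ _ h => Subtype.ext (congrArg (fun x => x.1) h)

theorem card_piFinset_Icc_floor_le {p : ℕ} {Y : Fin p → ℝ} (hY : ∀ i, 0 ≤ Y i) :
    ((Fintype.piFinset fun i => Finset.Icc (0 : ℤ) ⌊Y i⌋).card : ℝ) ≤ ∏ i, (Y i + 1) := by
  rw [Fintype.card_piFinset, Nat.cast_prod]
  refine Finset.prod_le_prod (fun i _ => by positivity) fun i _ => ?_
  have h1 : (0 : ℤ) ≤ ⌊Y i⌋ := Int.floor_nonneg.2 (hY i)
  have h2 : (((⌊Y i⌋ + 1 - 0).toNat : ℤ) : ℝ) = (⌊Y i⌋ + 1 - 0 : ℤ) := by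
    rw [Int.toNat_of_nonneg (by omega)]
  rw [Int.card_Icc, ← Int.cast_natCast, h2]
  push_cast
  linarith [Int.floor_le (Y i)]

/-- The contribution of a single branch to the final estimate. -/
theorem branch_factor_eq {p n m i : ℕ} {ε C x : ℝ} (hn : 1 ≤ n) (hε : 0 < ε)
    (hm : m ≤ 2 * n) (hi : i < p) (hx : x = C * √n) (g : ℝ) :
    (x * g) * ((x * g * (3 * 4 ^ p * 2 ^ m /
      ((ε * n) ^ (2 * (p - 1 - i) + 1) * (√ε * √n))) * (C ^ 2 * n) ^ (p - 1 - i)) *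
      (x * g * (3 * 4 ^ p * 2 ^ (2 * n - m) /
      ((ε * n) ^ (2 * (p - 1 - i) + 1) * (√ε * √n))) * (C ^ 2 * n) ^ (p - 1 - i))) =
    (C ^ 3 * (18 * 16 ^ p * C ^ (4 * (p - 1 - i)) * (1 + 2 * p) ^ (2 * p - 1) /
      ε ^ (4 * (p - 1 - i) + 3))) * g ^ 3 *
      ((4 : ℝ) ^ n * n ^ (2 * i) / (2 * √n * ((1 + 2 * p) * n) ^ (2 * p - 1))) := by
  have hn0 : (0 : ℝ) < n := by exact_mod_cast hn
  have hsq : 0 < √(n : ℝ) := Real.sqrt_pos.2 hn0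
  have hsε : 0 < √ε := Real.sqrt_pos.2 hε
  have h1 : (2 : ℝ) ^ (2 * n - m) = 4 ^ n / 2 ^ m := by
    rw [eq_div_iff (by positivity), ← pow_add, Nat.sub_add_cancel hm, pow_mul]
    norm_num
  obtain ⟨q, rfl⟩ := Nat.exists_eq_add_of_lt hi
  rw [show i + q + 1 - 1 - i = q by omega, show 2 * (i + q + 1) - 1 = 2 * i + 2 * q + 1 by omega,
    hx, h1]
  set s := √(n : ℝ) with hs
  set a := √ε with ha
  have hns : (n : ℝ) = s ^ 2 := (Real.sq_sqrt hn0.le).symm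
  have hεa : ε = a ^ 2 := (Real.sq_sqrt hε.le).symm
  have h16 : (16 : ℝ) ^ (i + q + 1) = (4 ^ (i + q + 1)) ^ 2 := by
    rw [← pow_mul, mul_comm _ 2, pow_mul]; norm_num
  rw [hns, hεa, h16]
  generalize (4 : ℝ) ^ n = A
  generalize (4 : ℝ) ^ (i + q + 1) = B
  have h2m : (2 : ℝ) ^ m ≠ 0 := by positivity
  generalize (2 : ℝ) ^ m = D at h2m ⊢
  have hp : (1 + 2 * ((i + q + 1 : ℕ) : ℝ)) ≠ 0 := by positivity
  generalize (1 + 2 * ((i + q + 1 : ℕ) : ℝ)) = F at hp ⊢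
  simp only [mul_pow]
  field_simp
  ring

theorem card_isMelonW_and_le {p n m : ℕ} {ε C : ℝ} (hn : 1 ≤ n) (hpn : p ≤ n) (hε : 0 < ε)
    (hm : m ≤ 2 * n) (hm1 : ε * n ≤ m) (hm2 : ε * n ≤ (2 * n - m : ℕ)) (hC : 0 ≤ C)
    (hCε : C * √n ≤ ε * n) {g Y : Fin p → ℝ} (hg0 : ∀ i, 0 ≤ g i) (hg1 : ∀ i, g i ≤ 1)
    (hY0 : ∀ i, 0 ≤ Y i) (hYg : ∀ i, Y i + 1 ≤ C * √n * g i) {E : (Fin p → ℕ → ℤ) → Prop}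
    (hE : ∀ w, IsMelonW p n w → E w → ∀ i, (w i m : ℝ) ≤ Y i) :
    (Nat.card {w : Fin p → ℕ → ℤ // IsMelonW p n w ∧ E w} : ℝ) ≤
      (∏ i : Fin p, (C ^ 3 * (18 * 16 ^ p * C ^ (4 * (p - 1 - i : ℕ)) * (1 + 2 * p) ^ (2 * p - 1) /
        ε ^ (4 * (p - 1 - i : ℕ) + 3)))) * (∏ i, g i) ^ 3 *
        Nat.card {w : Fin p → ℕ → ℤ // IsMelonW p n w} := by
  have hs : 0 ≤ √(n : ℝ) := Real.sqrt_nonneg _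
  set T := Fintype.piFinset fun i => Finset.Icc (0 : ℤ) ⌊Y i⌋ with hTdef
  have hT : ∀ w, IsMelonW p n w → E w → (fun i => w i m) ∈ T := fun w hw hEw =>
    Fintype.mem_piFinset.2 fun i =>
      Finset.mem_Icc.2 ⟨hw.1.2.2.1 i m hm, Int.le_floor.2 (hE w hw hEw i)⟩
  have hX0 : ∀ i, 0 ≤ C * √n * g i := fun i => mul_nonneg (mul_nonneg hC hs) (hg0 i)
  have hXC : ∀ i, C * √n * g i ≤ C * √n := fun i =>
    mul_le_of_le_one_right (mul_nonneg hC hs) (hg1 i)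
  have heX : ∀ e ∈ T, ∀ i, (e i : ℝ) + 1 ≤ C * √n * g i := by
    intro e he i
    have h1 := Int.le_floor.1 (Finset.mem_Icc.1 (Fintype.mem_piFinset.1 he i)).2
    linarith [hYg i]
  have hem : ∀ m' : ℕ, ε * n ≤ m' → ∀ e ∈ T, ∀ i, e i ≤ m' := by
    intro m' hm' e he i
    have h1 := heX e he i
    have h2 := hXC i
    have h3 : (e i : ℝ) ≤ m' := by linarith
    exact_mod_cast h3
  have hcard := card_piFinset_Icc_floor_le hY0
  have hcount : ∀ m' : ℕ, ε * n ≤ m' → ∀ e ∈ T, _ := fun m' hm' e he =>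
    starCount_le hn hε hm' (hem m' hm' e he) (heX e he) hX0 hXC
  have hsum : (Nat.card {w : Fin p → ℕ → ℤ // IsMelonW p n w ∧ E w} : ℝ) ≤
      ∑ e ∈ T, (starCount m e : ℝ) * starCount (2 * n - m) e := by
    exact_mod_cast card_isMelonW_and_le_sum hm hT
  have hlow := le_starCount hn hpn
  refine hsum.trans ((Finset.sum_le_sum fun e he =>
    mul_le_mul (hcount m hm1 e he) (hcount _ hm2 e he) (by positivity)
      ((Nat.cast_nonneg _).trans (hcount m hm1 e he))).trans ?_)
  rw [Finset.sum_const, nsmul_eq_mul]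
  refine (mul_le_mul_of_nonneg_right (hcard.trans (Finset.prod_le_prod
    (fun i _ => by linarith [hY0 i]) fun i _ => hYg i)) ?_).trans ?_
  · rw [← Finset.prod_mul_distrib]
    exact Finset.prod_nonneg fun i _ => by have := hX0 i; positivity
  rw [← Finset.prod_mul_distrib, ← Finset.prod_mul_distrib,
    Finset.prod_congr rfl fun i _ => branch_factor_eq hn hε hm i.2 rfl (g i),
    Finset.prod_mul_distrib, Finset.prod_mul_distrib, Finset.prod_pow]
  refine mul_le_mul_of_nonneg_left hlow ?_
  exact mul_nonneg (Finset.prod_nonneg fun i _ => by positivity)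
    (pow_nonneg (Finset.prod_nonneg fun i _ => hg0 i) 3)

/-- the probability that the lowest branch is below `n^α` while all
branches are below `r·√(2n)` at time `⌊2nt⌋` is `O(n^{3(α−1/2)})`, uniformly in
`t ∈ [ε, 1−ε]`. -/
theorem melonW_lowest_branch_small_prob (p : ℕ) (hp : 1 ≤ p)
    (ε : ℝ) (hε0 : 0 < ε) (hε : ε < 1 / 2) (r : ℝ) (hr : 0 < r)
    (α : ℝ) (hα0 : 0 < α) (hα : α < 1 / 4) :
    ∃ c > (0 : ℝ), ∀ n : ℕ, 1 ≤ n → ∀ t : ℝ, ε ≤ t → t ≤ 1 - ε →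
      probW p n (fun w =>
          (w ⟨0, by omega⟩ ⌊2 * (n : ℝ) * t⌋₊ : ℝ) ≤ (n : ℝ) ^ α ∧
          (w ⟨p - 1, by omega⟩ ⌊2 * (n : ℝ) * t⌋₊ : ℝ) ≤ r * Real.sqrt (2 * n))
        ≤ c * (n : ℝ) ^ (3 * (α - 1 / 2)) := by
  have hC2 : 2 ≤ r * √2 + 2 := by linarith [mul_nonneg hr.le (Real.sqrt_nonneg 2)]
  set C := r * √2 + 2 with hCdef
  set K : ℝ := ∏ i : Fin p, (C ^ 3 * (18 * 16 ^ p * C ^ (4 * (p - 1 - i : ℕ)) *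
    (1 + 2 * p) ^ (2 * p - 1) / ε ^ (4 * (p - 1 - i : ℕ) + 3))) with hK
  have hK0 : 0 ≤ K := Finset.prod_nonneg fun i _ => by positivity
  set N : ℕ := ⌈(C / ε) ^ 2⌉₊ + ⌈1 / ε⌉₊ + p with hN
  have hN0 : (0 : ℝ) < N := by exact_mod_cast (by omega : 0 < N)
  refine ⟨K + (N : ℝ) ^ (3 * (1 / 2 - α)), by positivity, fun n hn t ht1 ht2 => ?_⟩
  have hn0 : (0 : ℝ) < n := by exact_mod_cast hn
  have hn1 : (1 : ℝ) ≤ n := by exact_mod_cast hn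
  have hpow0 : (0 : ℝ) < (n : ℝ) ^ (3 * (α - 1 / 2)) := Real.rpow_pos_of_pos hn0 _
  rcases lt_or_ge n N with hnN | hnN
  · refine (probW_le_one p n _).trans ?_
    have h1 : (n : ℝ) ^ (3 * (1 / 2 - α)) ≤ (N : ℝ) ^ (3 * (1 / 2 - α)) :=
      Real.rpow_le_rpow hn0.le (by exact_mod_cast hnN.le) (by linarith)
    calc (1 : ℝ) = (n : ℝ) ^ (3 * (1 / 2 - α)) * (n : ℝ) ^ (3 * (α - 1 / 2)) := by
          rw [← Real.rpow_add hn0]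
          ring_nf
          simp
      _ ≤ _ := by gcongr; linarith
  have hpn : p ≤ n := by omega
  have hnε : 1 ≤ ε * n := by
    have h1 : (⌈1 / ε⌉₊ : ℝ) ≤ n := by exact_mod_cast (by omega : ⌈1 / ε⌉₊ ≤ n)
    have h2 := (Nat.le_ceil (1 / ε)).trans h1
    rwa [div_le_iff₀' hε0] at h2
  have hCε : C * √n ≤ ε * n := by
    have h1 : (⌈(C / ε) ^ 2⌉₊ : ℝ) ≤ n := by exact_mod_cast (by omega : ⌈(C / ε) ^ 2⌉₊ ≤ n)
    have h2 := Real.le_sqrt_of_sq_le ((Nat.le_ceil ((C / ε) ^ 2)).trans h1)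
    rw [div_le_iff₀' hε0] at h2
    calc C * √n ≤ ε * √n * √n := by gcongr
      _ = ε * n := by rw [mul_assoc, Real.mul_self_sqrt hn0.le]
  set m := ⌊2 * (n : ℝ) * t⌋₊ with hmdef
  have ht0 : 0 ≤ 2 * (n : ℝ) * t := by nlinarith
  have hmle : (m : ℝ) ≤ 2 * n * t := Nat.floor_le ht0
  have hmgt : 2 * (n : ℝ) * t < m + 1 := Nat.lt_floor_add_one _
  have hm2n : (m : ℝ) ≤ 2 * n - ε * n := by nlinarith
  have hm : m ≤ 2 * n := by
    have : (m : ℝ) ≤ 2 * n := by nlinarith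
    exact_mod_cast this
  have hm1 : ε * n ≤ m := by nlinarith
  have hm2 : ε * n ≤ (2 * n - m : ℕ) := by
    rw [Nat.cast_sub hm]
    push_cast
    linarith
  have hs1 : 1 ≤ √(n : ℝ) := Real.one_le_sqrt.2 hn1
  have hs0 : 0 < √(n : ℝ) := by linarith
  have hnα1 : 1 ≤ (n : ℝ) ^ α := Real.one_le_rpow hn1 hα0.le
  have hnα : (n : ℝ) ^ α ≤ √n := by
    rw [Real.sqrt_eq_rpow]
    exact Real.rpow_le_rpow_of_exponent_le hn1 (by linarith)
  have hcard := card_isMelonW_and_le hn hpn hε0 hm hm1 hm2 (by linarith : 0 ≤ C) hCε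
    (g := fun i => if i = ⟨0, by omega⟩ then (n : ℝ) ^ α / √n else 1)
    (Y := fun i => if i = ⟨0, by omega⟩ then (n : ℝ) ^ α else r * √(2 * n))
    (E := fun w => (w ⟨0, by omega⟩ m : ℝ) ≤ (n : ℝ) ^ α ∧
      (w ⟨p - 1, by omega⟩ m : ℝ) ≤ r * √(2 * n))
    (fun i => by split_ifs <;> positivity)
    (fun i => by
      split_ifs
      · exact (div_le_one hs0).2 hnα
      · exact le_rfl)
    (fun i => by split_ifs <;> positivity)
    (fun i => by
      split_ifs
      · rw [mul_assoc, mul_div_cancel₀ _ hs0.ne']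
        nlinarith
      · rw [Real.sqrt_mul (by norm_num), hCdef]
        linarith)
    (fun w hw hE i => by
      split_ifs with hi
      · rw [hi]
        exact hE.1
      · refine le_trans ?_ hE.2
        have h1 : i ≤ ⟨p - 1, by omega⟩ := Fin.le_def.2 (by simp only; omega)
        rcases h1.eq_or_lt with h2 | h2
        · rw [h2]
        · exact_mod_cast (hw.1.2.2.2.1 i _ h2 m hm).le)
  rw [Finset.prod_ite_eq' Finset.univ, if_pos (Finset.mem_univ _)] at hcard
  have hδ : ((n : ℝ) ^ α / √n) ^ 3 = (n : ℝ) ^ (3 * (α - 1 / 2)) := by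
    rw [Real.sqrt_eq_rpow, ← Real.rpow_sub hn0, ← Real.rpow_natCast, ← Real.rpow_mul hn0.le]
    congr 1
    push_cast
    ring
  rw [hδ] at hcard
  calc probW p n _ ≤ K * (n : ℝ) ^ (3 * (α - 1 / 2)) :=
        div_le_of_le_mul₀ (by positivity) (by positivity) hcard
    _ ≤ _ := by
      gcongr
      have : 0 ≤ (N : ℝ) ^ (3 * (1 / 2 - α)) := by positivity
      linarith
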